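/- Let G = L₂(v) = PSL(2, 𝔽_v), where v > 3 is a prime. Suppose G acts linearly on a nonzero vector space W over a field of prime characteristic w, where w does not divide |G|. If r and s are two distinct odd primes dividing |G|, then {r, s, w} is not a coclique in the prime graph of the semidirect product W ⋊ G; that is, at least one of rs, rw, sw is the order of an element of W ⋊ G. -/

import Mathlib

open scoped MatrixGroups

/-- The spectrum of a group: the set of orders of its elements. -/
def specSet (G : Type*) [Group G] : Set ℕ := {n | ∃ g : G, orderOf g = n}

/-- The group of `F`-linear automorphisms of `W`, viewed as (multiplicative)
automorphisms of the abelian group `W`. -/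
def linearAut (F W : Type*) [Field F] [AddCommGroup W] [Module F W] :
    (W ≃ₗ[F] W) →* MulAut (Multiplicative W) where
  toFun e := AddEquiv.toMultiplicative e.toAddEquiv
  map_one' := rfl
  map_mul' _ _ := rfl

open Module

section LinearActions

variable {G F W : Type*} [Group G] [Field F] [AddCommGroup W] [Module F W]

/-- The sum of a representation over a finite set stable under left translation by an element
without nonzero fixed vectors is zero. -/
lemma sum_eq_zero_of_fixedFree (φ : G →* End F W) (T : Finset G) (t : G)
    (hT : ∀ g, g ∈ T ↔ t * g ∈ T) (ht : ∀ x, φ t x = x → x = 0) : ∑ g ∈ T, φ g = 0 := by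
  have key : φ t * ∑ g ∈ T, φ g = ∑ g ∈ T, φ g := by
    rw [Finset.mul_sum]
    refine Finset.sum_equiv (Equiv.mulLeft t) (fun g => by simpa using hT g) (fun g _ => ?_)
    simp
  ext x
  exact ht _ (by simpa using LinearMap.congr_fun key x)

/-- The sum of all powers of a finite-order automorphism without nonzero fixed vectors is zero. -/
lemma sum_pow_eq_zero_of_fixedFree (f : End F W) (r : ℕ) (hr : f ^ r = 1)
    (hf : ∀ x, f x = x → x = 0) : ∑ i ∈ Finset.range r, f ^ i = 0 := by
  have key : f * ∑ i ∈ Finset.range r, f ^ i = ∑ i ∈ Finset.range r, f ^ i := by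
    rw [← sub_eq_zero, ← sub_one_mul, mul_geom_sum, hr, sub_self]
  ext x
  exact hf _ (by simpa using LinearMap.congr_fun key x)

variable [Fintype G]

/-- The sum of `φ` over all conjugates of `g`, indexed by the conjugating element. -/
def conjSum (φ : G →* End F W) (g : G) : End F W := ∑ h, φ h * φ g * φ h⁻¹

lemma conjSum_conj (φ : G →* End F W) (k g : G) : conjSum φ (k * g * k⁻¹) = conjSum φ g := by
  refine Finset.sum_equiv (Equiv.mulRight k) (by simp) (fun h _ => ?_)
  simp [← map_mul, mul_assoc]

lemma sum_conjSum (φ : G →* End F W) (T : Finset G) :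
    ∑ g ∈ T, conjSum φ g = ∑ h, φ h * (∑ g ∈ T, φ g) * φ h⁻¹ := by
  simp only [conjSum, Finset.mul_sum, Finset.sum_mul]
  exact Finset.sum_comm

lemma conjSum_one (φ : G →* End F W) : conjSum φ 1 = (Fintype.card G : End F W) := by
  simp [conjSum, ← map_mul]

end LinearActions

section Elements

variable {K : Type*} [Field K]

lemma sl2_ext {g h : SL(2, K)} (h00 : g 0 0 = h 0 0) (h01 : g 0 1 = h 0 1)
    (h10 : g 1 0 = h 1 0) (h11 : g 1 1 = h 1 1) : g = h := by
  ext i j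
  fin_cases i <;> fin_cases j <;> assumption

lemma sl2_mul_apply (g h : SL(2, K)) (i j : Fin 2) :
    (g * h) i j = g i 0 * h 0 j + g i 1 * h 1 j := by
  simp [Matrix.mul_apply, Fin.sum_univ_two]

lemma sl2_det (g : SL(2, K)) : g 0 0 * g 1 1 - g 0 1 * g 1 0 = 1 := by
  rw [← Matrix.det_fin_two]; exact g.2

/-- The element of `SL(2, K)` with the given entries. -/
def sl2Mk (a b c d : K) (h : a * d - b * c = 1) : SL(2, K) :=
  ⟨!![a, b; c, d], by rw [Matrix.det_fin_two_of]; exact h⟩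

section
variable (a b c d : K) (h : a * d - b * c = 1)
@[simp] lemma sl2Mk_00 : sl2Mk a b c d h 0 0 = a := rfl
@[simp] lemma sl2Mk_01 : sl2Mk a b c d h 0 1 = b := rfl
@[simp] lemma sl2Mk_10 : sl2Mk a b c d h 1 0 = c := rfl
@[simp] lemma sl2Mk_11 : sl2Mk a b c d h 1 1 = d := rfl
end

/-- The transvection `v ↦ v + b ω(e, v) e`, where `e = (x, y)` and `ω` is the determinant. -/
def unip (x y b : K) : SL(2, K) :=
  sl2Mk (1 - b * (x * y)) (b * x ^ 2) (-(b * y ^ 2)) (1 + b * (x * y)) (by ring)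

lemma unip_add (x y b c : K) : unip x y (b + c) = unip x y b * unip x y c := by
  apply sl2_ext <;> simp [sl2_mul_apply, unip] <;> ring

lemma unip_zero (x y : K) : unip x y 0 = 1 := by
  apply sl2_ext <;> simp [unip]

lemma unip_inv (x y b : K) : (unip x y b)⁻¹ = unip x y (-b) := by
  rw [inv_eq_iff_mul_eq_one, ← unip_add, add_neg_cancel, unip_zero]

lemma unip_pow (x y b : K) (n : ℕ) : unip x y b ^ n = unip x y (n * b) := by
  induction n with
  | zero => simp [unip_zero]
  | succ n ih => rw [pow_succ, ih, ← unip_add]; congr 1; push_cast; ring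

lemma unip_injective {x y : K} (hxy : x ≠ 0 ∨ y ≠ 0) : Function.Injective (unip x y) := by
  intro b c h
  have h1 := congrArg (fun g : SL(2, K) => g 0 1) h
  have h2 := congrArg (fun g : SL(2, K) => g 1 0) h
  simp only [unip, sl2Mk_01, sl2Mk_10, neg_inj] at h1 h2
  rcases hxy with hx | hy
  · exact mul_right_cancel₀ (pow_ne_zero 2 hx) h1
  · exact mul_right_cancel₀ (pow_ne_zero 2 hy) h2

lemma orderOf_unip {p : ℕ} (hp : p.Prime) [CharP K p] {x y b : K} (hxy : x ≠ 0 ∨ y ≠ 0)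
    (hb : b ≠ 0) : orderOf (unip x y b) = p := by
  have := Fact.mk hp
  refine orderOf_eq_prime ?_ ?_
  · rw [unip_pow, CharP.cast_eq_zero, zero_mul, unip_zero]
  · rw [← unip_zero x y]
    exact fun h => hb (unip_injective hxy h)

/-- Conjugating transvections along an eigenvector rescales the parameter. -/
lemma unip_mul_of_eigen {g : SL(2, K)} {x y l m : K} (hlm : l * m = 1)
    (h0 : g 0 0 * x + g 0 1 * y = l * x) (h1 : g 1 0 * x + g 1 1 * y = l * y) (b : K) :
    unip x y b * g = g * unip x y (m ^ 2 * b) := by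
  have hd := sl2_det g
  have k0 : g 1 1 * x - g 0 1 * y = m * x := by
    linear_combination (-g 1 1 * m) * h0 + (g 0 1 * m) * h1 + (m * x) * hd
      + (g 0 1 * y - g 1 1 * x) * hlm
  have k1 : g 0 0 * y - g 1 0 * x = m * y := by
    linear_combination (g 1 0 * m) * h0 - (g 0 0 * m) * h1 + (m * y) * hd
      + (g 1 0 * x - g 0 0 * y) * hlm
  apply sl2_ext <;> simp only [sl2_mul_apply, unip, sl2Mk_00, sl2Mk_01, sl2Mk_10, sl2Mk_11]
  · linear_combination (-b * x) * k1 + (m ^ 2 * b * y) * h0 + (b * m * x * y) * hlm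
  · linear_combination (b * x) * k0 - (m ^ 2 * b * x) * h0 - (b * m * x * x) * hlm
  · linear_combination (-b * y) * k1 + (m ^ 2 * b * y) * h1 + (b * m * y * y) * hlm
  · linear_combination (b * y) * k0 - (m ^ 2 * b * x) * h1 - (b * m * x * y) * hlm

lemma unip_conj_of_eigen {g : SL(2, K)} {x y l m : K} (hlm : l * m = 1)
    (h0 : g 0 0 * x + g 0 1 * y = l * x) (h1 : g 1 0 * x + g 1 1 * y = l * y) (b : K) :
    unip x y b * g * (unip x y b)⁻¹ = g * unip x y ((m ^ 2 - 1) * b) := by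
  rw [unip_mul_of_eigen hlm h0 h1, unip_inv, mul_assoc, ← unip_add]
  congr 2; ring

/-- The diagonal element with entries `a` and `a⁻¹`. -/
def diagElt (a : Kˣ) : SL(2, K) := sl2Mk a 0 0 (a⁻¹ : Kˣ) (by simp)

lemma diagElt_pow (a : Kˣ) (n : ℕ) : diagElt a ^ n = diagElt (a ^ n) := by
  induction n with
  | zero => apply sl2_ext <;> simp [diagElt]
  | succ n ih =>
    rw [pow_succ, ih]
    apply sl2_ext <;> simp [diagElt, sl2_mul_apply, pow_succ, mul_comm]

lemma diagElt_injective : Function.Injective (diagElt : Kˣ → SL(2, K)) := fun _ _ h =>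
  Units.ext (congrArg (fun g : SL(2, K) => g 0 0) h)

lemma diagElt_one : diagElt (1 : Kˣ) = 1 := by apply sl2_ext <;> simp [diagElt]

lemma orderOf_diagElt {r : ℕ} (hr : r.Prime) {a : Kˣ} (ha : orderOf a = r) :
    orderOf (diagElt a) = r := by
  have := Fact.mk hr
  refine orderOf_eq_prime ?_ ?_
  · rw [diagElt_pow, ← ha, pow_orderOf_eq_one, diagElt_one]
  · rw [← diagElt_one]
    intro h
    rw [diagElt_injective h, orderOf_one] at ha
    exact hr.one_lt.ne ha

/-- An endomorphism-valued representation trivial on the upper unitriangular subgroup is trivial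
on the diagonal torus. -/
lemma map_diagElt_eq_one {M : Type*} [Monoid M] (φ : SL(2, K) →* M)
    (h : ∀ b, φ (unip 1 0 b) = 1) (a : Kˣ) : φ (diagElt a) = 1 := by
  have hS : ∀ b : K, unip 0 1 b =
      sl2Mk 0 (-1) 1 0 (by ring) * unip 1 0 b * (sl2Mk 0 (-1) 1 0 (by ring))⁻¹ := by
    intro b
    rw [eq_mul_inv_iff_mul_eq]
    apply sl2_ext <;> simp [sl2_mul_apply, unip]
  have hl : ∀ b, φ (unip 0 1 b) = 1 := by
    intro b
    rw [hS, map_mul, map_mul, h, mul_one, ← map_mul, mul_inv_cancel, map_one]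
  have hprod : diagElt a = unip 1 0 (a : K) * unip 0 1 ((a⁻¹ : Kˣ) : K) * unip 1 0 (a : K) *
      (unip 1 0 (-1) * unip 0 1 (-1) * unip 1 0 (-1)) := by
    apply sl2_ext <;> simp [sl2_mul_apply, unip, diagElt]
  rw [hprod]
  simp [h, hl]

end Elements

section SplitTorus

variable {K F W : Type*} [Field K] [Fintype K] [Field F] [AddCommGroup W] [Module F W]

lemma sum_unip_mul {M : Type*} [Semiring M] (φ : SL(2, K) →* M) {x y k : K} (hk : k ≠ 0) :
    ∑ b, φ (unip x y (k * b)) = ∑ b, φ (unip x y b) :=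
  Fintype.sum_equiv (Equiv.mulLeft₀ k hk) _ _ (fun _ => rfl)

lemma unip_mul_sum {M : Type*} [Semiring M] (φ : SL(2, K) →* M) (x y c : K) :
    φ (unip x y c) * ∑ b, φ (unip x y b) = ∑ b, φ (unip x y b) := by
  rw [Finset.mul_sum]
  exact Fintype.sum_equiv (Equiv.addLeft c) _ _ (fun b => by simp [unip_add])

/-- An element of odd prime order in the split torus has a nonzero fixed vector. -/
lemma exists_fixed_of_diagElt [Nontrivial W] (hq : (Fintype.card K : F) ≠ 0)
    (φ : SL(2, K) →* End F W) {r : ℕ} (hr : r.Prime) (hrodd : Odd r) {a : Kˣ}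
    (ha : orderOf a = r) : ∃ x, x ≠ 0 ∧ φ (diagElt a) x = x := by
  by_contra! hcon
  have hfix : ∀ x, φ (diagElt a) x = x → x = 0 := fun x hx => by
    by_contra h0
    exact hcon x h0 hx
  have hpow : φ (diagElt a) ^ r = 1 := by
    rw [← map_pow, diagElt_pow, ← ha, pow_orderOf_eq_one, diagElt_one, map_one]
  have hsum := sum_pow_eq_zero_of_fixedFree _ r hpow hfix
  obtain ⟨n, rfl⟩ : ∃ n, r = n + 1 := ⟨r - 1, by have := hr.pos; omega⟩
  set U : End F W := ∑ b : K, φ (unip 1 0 b) with hU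
  have hterm : ∀ i ∈ Finset.range n,
      ∑ b : K, φ (unip 1 0 b) * φ (diagElt a) ^ (i + 1) * φ (unip 1 0 b)⁻¹ =
        φ (diagElt a) ^ (i + 1) * U := by
    intro i hi
    have hi' := Finset.mem_range.1 hi
    have hne : (((a ^ (i + 1))⁻¹ : Kˣ) : K) ^ 2 - 1 ≠ 0 := by
      intro h
      have h2 : ((a ^ (i + 1))⁻¹) ^ 2 = 1 := by
        apply Units.ext
        push_cast
        push_cast at h
        linear_combination h
      rw [inv_pow, inv_eq_one, ← pow_mul] at h2
      have h3 := orderOf_dvd_of_pow_eq_one h2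
      rw [ha] at h3
      rcases (Nat.Prime.dvd_mul hr).1 h3 with h4 | h4
      · exact absurd (Nat.le_of_dvd (by omega) h4) (by omega)
      · have := (Nat.prime_dvd_prime_iff_eq hr Nat.prime_two).1 h4
        rw [this] at hrodd
        exact absurd hrodd (by decide)
    rw [hU, ← sum_unip_mul φ hne, Finset.mul_sum]
    refine Finset.sum_congr rfl fun b _ => ?_
    rw [← map_pow, ← map_mul, ← map_mul, ← map_mul, diagElt_pow,
      unip_conj_of_eigen (l := ((a ^ (i + 1) : Kˣ) : K)) (m := (((a ^ (i + 1))⁻¹ : Kˣ) : K))] <;>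
      simp [diagElt]
  have hzero : ∑ b : K, φ (unip 1 0 b) * (∑ i ∈ Finset.range (n + 1), φ (diagElt a) ^ i) *
      φ (unip 1 0 b)⁻¹ = 0 := by simp [hsum]
  have hqU : (Fintype.card K : End F W) = U := by
    simp only [Finset.mul_sum, Finset.sum_mul] at hzero
    rw [Finset.sum_comm, Finset.sum_range_succ', Finset.sum_congr rfl hterm, ← Finset.sum_mul]
      at hzero
    rw [Finset.sum_range_succ', pow_zero] at hsum
    rw [eq_neg_of_add_eq_zero_left hsum] at hzero
    simp only [pow_zero, mul_one, ← map_mul, mul_inv_cancel, map_one, Finset.sum_const,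
      Finset.card_univ, nsmul_eq_mul, neg_mul, one_mul] at hzero
    exact (neg_add_eq_zero.1 hzero).symm
  have hunip : ∀ b : K, φ (unip 1 0 b) = 1 := by
    intro b
    have h1 : φ (unip 1 0 b) * U = U := unip_mul_sum φ 1 0 b
    rw [← hqU] at h1
    ext x
    have h2 := LinearMap.congr_fun h1 x
    have h3 : ∀ y : W, (Fintype.card K : End F W) y = (Fintype.card K : F) • y := by
      intro y
      rw [Module.End.natCast_apply, Nat.cast_smul_eq_nsmul]
    rw [Module.End.mul_apply, h3, map_smul] at h2
    exact smul_right_injective W hq h2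
  obtain ⟨x, hx⟩ := exists_ne (0 : W)
  refine hcon x hx ?_
  rw [map_diagElt_eq_one φ hunip a]
  rfl

end SplitTorus

section Torus

variable {K : Type*} [Field K]

/-- The elements of `SL(2, K)` in the span of `1` and the traceless matrix `!![x, y; z, -x]`,
where `X = (x, y, z)`. -/
def torus (X : K × K × K) : Subgroup SL(2, K) where
  carrier := {g | ∃ b, g 0 0 = g 1 1 + 2 * b * X.1 ∧ g 0 1 = b * X.2.1 ∧ g 1 0 = b * X.2.2}
  one_mem' := ⟨0, by simp⟩
  mul_mem' := by
    rintro g h ⟨b, h1, h2, h3⟩ ⟨c, k1, k2, k3⟩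
    refine ⟨g 0 0 * c + b * h 1 1, ?_, ?_, ?_⟩ <;> 
      simp only [sl2_mul_apply, h1, h2, h3, k1, k2, k3] <;> ring
  inv_mem' := by
    rintro g ⟨b, h1, h2, h3⟩
    refine ⟨-b, ?_, ?_, ?_⟩ <;> rw [Matrix.SpecialLinearGroup.SL2_inv_expl]
    · simp [h1]
    · simp [h2]
    · simp [h3]

lemma commute_of_mem_torus {X : K × K × K} {g h : SL(2, K)} (hg : g ∈ torus X)
    (hh : h ∈ torus X) : Commute g h := by
  obtain ⟨b, h1, h2, h3⟩ := hg
  obtain ⟨c, k1, k2, k3⟩ := hh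
  apply sl2_ext <;> simp only [sl2_mul_apply, h1, h2, h3, k1, k2, k3] <;> ring

/-- The square of the traceless matrix attached to `X`. -/
def disc (X : K × K × K) : K := X.1 ^ 2 + X.2.1 * X.2.2

lemma neg_one_mem_torus (X : K × K × K) : (-1 : SL(2, K)) ∈ torus X := ⟨0, by simp⟩

lemma eq_one_or_neg_one {g : SL(2, K)} (h0 : g 0 0 = g 1 1) (h1 : g 0 1 = 0) (h2 : g 1 0 = 0) :
    g = 1 ∨ g = -1 := by
  have hd := sl2_det g
  rw [h1, h0] at hd
  have : g 1 1 = 1 ∨ g 1 1 = -1 := by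
    rw [← sq_eq_one_iff]; linear_combination hd
  rcases this with h | h
  · left; apply sl2_ext <;> simp [*]
  · right; apply sl2_ext <;> simp [*]

lemma card_torus [Fintype K] (h2 : (2 : K) ≠ 0) (X : K × K × K) (hX : ¬ IsSquare (disc X)) :
    Nat.card (torus X) = Fintype.card K + 1 := by
  obtain ⟨x, y, z⟩ := X
  set D := disc (x, y, z) with hD
  have hD' : D = x ^ 2 + y * z := rfl
  have hy : y ≠ 0 := by
    rintro rfl
    exact hX ⟨x, by rw [hD']; ring⟩
  have hden : ∀ m : K, 1 - D * m ^ 2 ≠ 0 := by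
    intro m hm
    have hm0 : m ≠ 0 := by rintro rfl; simp at hm
    exact hX ⟨m⁻¹, by field_simp; linear_combination -hm⟩
  let f : Option K → torus (x, y, z) := fun o => match o with
    | none => ⟨-1, neg_one_mem_torus _⟩
    | some m => ⟨sl2Mk ((1 + D * m ^ 2 + 2 * m * x) / (1 - D * m ^ 2)) (2 * m * y / (1 - D * m ^ 2))
        (2 * m * z / (1 - D * m ^ 2)) ((1 + D * m ^ 2 - 2 * m * x) / (1 - D * m ^ 2)) (by
          have := hden m
          field_simp
          rw [hD']; ring), ⟨2 * m / (1 - D * m ^ 2), by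
            have := hden m
            refine ⟨?_, ?_, ?_⟩ <;> simp only [sl2Mk_00, sl2Mk_01, sl2Mk_10, sl2Mk_11] <;>
              field_simp <;> ring⟩⟩
  have hf0 : ∀ m : K, (f (some m)).1 0 0 + (f (some m)).1 1 1 + 2 = 4 / (1 - D * m ^ 2) := by
    intro m
    have := hden m
    simp only [f, sl2Mk_00, sl2Mk_11]
    field_simp; ring
  have hf1 : ∀ m : K, (f (some m)).1 0 1 = 2 * m * y / (1 - D * m ^ 2) := fun m => rfl
  have h4 : (4 : K) ≠ 0 := by
    rw [show (4 : K) = 2 * 2 by norm_num]; exact mul_ne_zero h2 h2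
  have hnone : (f none).1 0 0 + (f none).1 1 1 + 2 = 0 := by
    simp only [f]; simp; norm_num
  have hbij : Function.Bijective f := by
    constructor
    · rintro (_ | m) (_ | n) h
      · rfl
      · have := hf0 n
        rw [← h, hnone] at this
        exact absurd this.symm (div_ne_zero h4 (hden n))
      · have := hf0 m
        rw [h, hnone] at this
        exact absurd this.symm (div_ne_zero h4 (hden m))
      · have e0 := hf0 m
        rw [h, hf0 n] at e0
        have e1 := hf1 m
        rw [h, hf1 n] at e1
        have hm := hden m
        have hn := hden n
        have e2 : 1 - D * m ^ 2 = 1 - D * n ^ 2 := by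
          field_simp at e0
          linear_combination e0
        rw [e2] at e1
        have e3 : n = m := mul_left_cancel₀ (mul_ne_zero h2 hy) (by
          linear_combination (div_left_inj' hn).1 e1)
        rw [e3]
    · rintro ⟨g, b, hb0, hb1, hb2⟩
      simp only at hb0 hb1 hb2
      have hd := sl2_det g
      rw [hb0, hb1, hb2] at hd
      -- `g = a + b X` with `a = g₁₁ + b x`
      have hab : (g 1 1 + b * x) ^ 2 - D * b ^ 2 = 1 := by rw [hD']; linear_combination hd
      by_cases ha : g 1 1 + b * x + 1 = 0
      · have hb : b = 0 := by
          have h5 : D * b ^ 2 = 0 := by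
            linear_combination (g 1 1 + b * x - 1) * ha - hab
          have hD0 : D ≠ 0 := fun h => hX (h ▸ IsSquare.zero)
          simpa [hD0] using h5
        subst hb
        refine ⟨none, Subtype.ext ?_⟩
        have h11 : g 1 1 = -1 := by linear_combination ha
        apply sl2_ext <;> simp [f, hb0, hb1, hb2, h11]
      · refine ⟨some (b / (g 1 1 + b * x + 1)), Subtype.ext ?_⟩
        have h6 : 1 - D * (b / (g 1 1 + b * x + 1)) ^ 2 = 2 / (g 1 1 + b * x + 1) := by
          field_simp
          linear_combination hab
        have h7 : 1 + D * (b / (g 1 1 + b * x + 1)) ^ 2 =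
            2 * (g 1 1 + b * x) / (g 1 1 + b * x + 1) := by
          field_simp
          linear_combination -hab
        apply sl2_ext <;>
          simp only [f, sl2Mk_00, sl2Mk_01, sl2Mk_10, sl2Mk_11, h6, h7, hb0, hb1, hb2] <;>
          field_simp <;> ring
  rw [← Nat.card_eq_of_bijective f hbij]
  simp

end Torus

section Counting

variable {K : Type*} [Field K] [Fintype K]

open Classical in
lemma card_torus_containing (h2 : (2 : K) ≠ 0) {g : SL(2, K)} (h1 : g ≠ 1) (hn : g ≠ -1) :
    (Finset.univ.filter fun X : K × K × K => X ≠ 0 ∧ g ∈ torus X).card = Fintype.card K - 1 := by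
  set X₀ : K × K × K := ((g 0 0 - g 1 1) / 2, g 0 1, g 1 0) with hX₀
  have hne : X₀ ≠ 0 := by
    intro h
    simp only [hX₀, Prod.mk_eq_zero, div_eq_zero_iff, h2, or_false] at h
    rcases eq_one_or_neg_one (sub_eq_zero.1 h.1) h.2.1 h.2.2 with h | h
    exacts [h1 h, hn h]
  have himg : (Finset.univ.filter fun X : K × K × K => X ≠ 0 ∧ g ∈ torus X) =
      Finset.univ.image fun t : Kˣ => (t : K) • X₀ := by
    ext X
    simp only [Finset.mem_filter, Finset.mem_univ, true_and, Finset.mem_image]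
    constructor
    · rintro ⟨-, b, hb0, hb1, hb2⟩
      have hX : X₀ = b • X := by
        ext <;> simp only [hX₀, Prod.smul_fst, Prod.smul_snd, smul_eq_mul]
        · rw [hb0]; field_simp; ring
        · exact hb1
        · exact hb2
      have hb : b ≠ 0 := by
        rintro rfl
        exact hne (by rw [hX, zero_smul])
      refine ⟨(Units.mk0 b hb)⁻¹, ?_⟩
      simp [hX, smul_smul, hb]
    · rintro ⟨t, rfl⟩
      refine ⟨smul_ne_zero t.ne_zero hne, ((t⁻¹ : Kˣ) : K), ?_, ?_, ?_⟩
      · simp [hX₀]; field_simp; ring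
      · simp [hX₀]
      · simp [hX₀]
  rw [himg, Finset.card_image_of_injective, Finset.card_univ, Fintype.card_units]
  intro s t h
  exact Units.ext (smul_left_injective K hne h)

open Classical in
lemma card_not_nonzero_sq (h2 : (2 : K) ≠ 0) :
    2 * (Finset.univ.filter fun D : K => ¬ ∃ d, d ≠ 0 ∧ d ^ 2 = D).card = Fintype.card K + 1 := by
  have hchar : ringChar K ≠ 2 := by
    intro h
    have := ringChar.Nat.cast_ringChar (R := K)
    rw [h] at this
    exact h2 (by exact_mod_cast this)
  have hpt : ∀ D : K, (2 * (if ¬ ∃ d, d ≠ 0 ∧ d ^ 2 = D then 1 else 0) : ℤ) =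
      1 - quadraticChar K D + if D = 0 then 1 else 0 := by
    intro D
    by_cases hD : D = 0
    · subst hD
      simp
    · by_cases hsq : IsSquare D
      · have : ∃ d : K, d ≠ 0 ∧ d ^ 2 = D := by
          obtain ⟨d, hd⟩ := hsq
          refine ⟨d, ?_, by rw [hd]; ring⟩
          rintro rfl
          exact hD (by simpa using hd)
        rw [(quadraticChar_one_iff_isSquare hD).2 hsq]
        simp [this, hD]
      · have : ¬ ∃ d : K, d ≠ 0 ∧ d ^ 2 = D := by
          rintro ⟨d, -, h⟩
          exact hsq ⟨d, by rw [← h]; ring⟩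
        rw [quadraticChar_neg_one_iff_not_isSquare.2 hsq]
        simp [this, hD]
  have hsum := Finset.sum_congr (rfl : (Finset.univ : Finset K) = _) fun D _ => hpt D
  rw [← Finset.mul_sum, Finset.sum_add_distrib, Finset.sum_sub_distrib,
    quadraticChar_sum_zero hchar] at hsum
  rw [← Nat.cast_inj (R := ℤ), Finset.card_filter]
  push_cast
  simpa using hsum

open Classical in
lemma card_nonsplit (h2 : (2 : K) ≠ 0) :
    2 * (Finset.univ.filter fun X : K × K × K =>
      X ≠ 0 ∧ ¬ ∃ d, d ≠ 0 ∧ d ^ 2 = disc X).card + 2 = Fintype.card K ^ 3 + Fintype.card K := by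
  set P : K → Prop := fun D => ¬ ∃ d, d ≠ 0 ∧ d ^ 2 = D with hP
  have hP0 : P 0 := by
    rintro ⟨d, hd, h⟩
    exact hd (by simpa using h)
  have hPsq : ∀ x : K, P (x ^ 2) ↔ x = 0 := by
    intro x
    constructor
    · intro h
      by_contra hx
      exact h ⟨x, hx, rfl⟩
    · rintro rfl
      simpa using hP0
  have hins : (Finset.univ.filter fun X : K × K × K => P (disc X)) =
      insert 0 (Finset.univ.filter fun X : K × K × K => X ≠ 0 ∧ P (disc X)) := by
    ext X
    simp only [Finset.mem_filter, Finset.mem_univ, true_and, Finset.mem_insert]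
    constructor
    · intro h
      by_cases hX : X = 0
      exacts [Or.inl hX, Or.inr ⟨hX, h⟩]
    · rintro (rfl | h)
      · simpa [disc] using hP0
      · exact h.2
  have hcard := congrArg Finset.card hins
  rw [Finset.card_insert_of_notMem (by simp)] at hcard
  set k := (Finset.univ.filter fun D : K => P D).card with hk
  have hk2 : 2 * k = Fintype.card K + 1 := card_not_nonzero_sq h2
  have hin : ∀ x y : K, ∑ z, (if P (x ^ 2 + y * z) then 1 else 0) =
      if y = 0 then (if x = 0 then Fintype.card K else 0) else k := by
    intro x y
    by_cases hy : y = 0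
    · subst hy
      by_cases hx : x = 0 <;> simp [hPsq, hx, hP0]
    · rw [if_neg hy, hk, Finset.card_filter]
      exact Fintype.sum_equiv ((Equiv.mulLeft₀ y hy).trans (Equiv.addLeft (x ^ 2))) _ _
        (fun z => by simp)
  have hy : ∀ x : K, ∑ y : K, (if y = 0 then (if x = 0 then Fintype.card K else 0) else k) =
      (if x = 0 then Fintype.card K else 0) + (Fintype.card K - 1) * k := by
    intro x
    rw [Fintype.sum_eq_add_sum_compl 0, if_pos rfl]
    congr 1
    rw [Finset.sum_congr rfl (g := fun _ => k)]
    · simp [Finset.card_compl]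
    · intro y hy
      rw [if_neg (by simpa using hy)]
  have hyz : ∀ x : K, ∑ Y : K × K, (if P (disc (x, Y)) then 1 else 0) =
      (if x = 0 then Fintype.card K else 0) + (Fintype.card K - 1) * k := by
    intro x
    rw [Fintype.sum_prod_type, ← hy x]
    exact Finset.sum_congr rfl fun y _ => hin x y
  have htot : ∑ X : K × K × K, (if P (disc X) then 1 else 0) =
      Fintype.card K + Fintype.card K * ((Fintype.card K - 1) * k) := by
    rw [Fintype.sum_prod_type, Finset.sum_congr rfl fun x _ => hyz x, Finset.sum_add_distrib]
    simp
  rw [Finset.card_filter, htot] at hcard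
  change 2 * (Finset.univ.filter fun X : K × K × K => X ≠ 0 ∧ P (disc X)).card + 2 = _
  obtain ⟨q, hq⟩ : ∃ q, Fintype.card K = q + 1 :=
    ⟨Fintype.card K - 1, by have := Fintype.card_pos (α := K); omega⟩
  rw [hq] at hcard hk2 ⊢
  rw [Nat.add_sub_cancel] at hcard
  have : 2 * (q + 1 + (q + 1) * (q * k)) = (q + 1) ^ 3 + (q + 1) := by
    linear_combination (q + 1) * q * hk2
  omega

end Counting

section NonsplitTorus

variable {K F W : Type*} [Field K] [Fintype K] [Field F] [AddCommGroup W] [Module F W]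

/-- The representation `φ` has no nonzero vector fixed by an element of order `n`. -/
def FixedFree {G : Type*} [Group G] (φ : G →* End F W) (n : ℕ) : Prop :=
  ∀ g, orderOf g = n → ∀ x, φ g x = x → x = 0

lemma sum_unip_eq_zero {p : ℕ} (hp : p.Prime) [CharP K p] (φ : SL(2, K) →* End F W)
    (hU : FixedFree φ p) {x y : K} (hxy : x ≠ 0 ∨ y ≠ 0) : ∑ b, φ (unip x y b) = 0 := by
  have key := unip_mul_sum φ x y 1
  ext w
  exact hU _ (orderOf_unip hp hxy one_ne_zero) _ (by simpa using LinearMap.congr_fun key w)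

lemma conjSum_eq_zero_of_split [Fintype SL(2, K)] {p : ℕ} (hp : p.Prime) [CharP K p]
    (h2 : (2 : K) ≠ 0) (hq : (Fintype.card K : F) ≠ 0) (φ : SL(2, K) →* End F W)
    (hU : FixedFree φ p) {X : K × K × K} {d : K} (hd : d ≠ 0) (hdX : d ^ 2 = disc X)
    {g : SL(2, K)} (hg : g ∈ torus X) (h1 : g ≠ 1) (hn : g ≠ -1) : conjSum φ g = 0 := by
  obtain ⟨x, y, z⟩ := X
  obtain ⟨b, hb0, hb1, hb2⟩ := hg
  simp only at hb0 hb1 hb2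
  replace hdX : d ^ 2 = x ^ 2 + y * z := hdX
  obtain ⟨e, f, hef, he, hf⟩ : ∃ e f, (e ≠ 0 ∨ f ≠ 0) ∧ x * e + y * f = d * e ∧
      z * e - x * f = d * f := by
    by_cases h : x + d ≠ 0 ∨ z ≠ 0
    · exact ⟨x + d, z, h, by linear_combination -hdX, by ring⟩
    · push Not at h
      refine ⟨y, 2 * d, Or.inr (mul_ne_zero h2 hd), ?_, ?_⟩
      · linear_combination y * h.1
      · linear_combination y * h.2 - 2 * d * h.1
  have hb : b ≠ 0 := by
    rintro rfl
    rcases eq_one_or_neg_one (g := g) (by simpa using hb0) (by simpa using hb1)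
      (by simpa using hb2) with h | h
    exacts [h1 h, hn h]
  have hdet := sl2_det g
  rw [hb0, hb1, hb2] at hdet
  have hlm : (g 1 1 + b * x + b * d) * (g 1 1 + b * x - b * d) = 1 := by
    linear_combination hdet - b ^ 2 * hdX
  have hk : (g 1 1 + b * x - b * d) ^ 2 - 1 ≠ 0 := by
    intro h
    have h3 : (g 1 1 + b * x - b * d) * (2 * b * d) = 0 := by linear_combination hlm - h
    exact mul_ne_zero (right_ne_zero_of_mul_eq_one hlm)
      (mul_ne_zero (mul_ne_zero h2 hb) hd) h3
  have hconj := unip_conj_of_eigen (g := g) (x := e) (y := f) hlm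
    (by rw [hb0, hb1]; linear_combination b * he) (by rw [hb2]; linear_combination b * hf)
  have hsum : ∑ c : K, conjSum φ (unip e f c * g * (unip e f c)⁻¹) = 0 := by
    simp only [hconj, conjSum]
    rw [Finset.sum_comm]
    refine Finset.sum_eq_zero fun h _ => ?_
    rw [← Finset.sum_mul, ← Finset.mul_sum]
    simp only [map_mul]
    rw [← Finset.mul_sum, sum_unip_mul φ hk, sum_unip_eq_zero hp φ hU hef]
    simp
  simp only [conjSum_conj, Finset.sum_const, Finset.card_univ] at hsum
  rw [← Nat.cast_smul_eq_nsmul F] at hsum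
  exact (smul_eq_zero.1 hsum).resolve_left hq

open Classical in
lemma sum_torus_eq_zero [Fintype SL(2, K)] {p : ℕ} (hp : p.Prime) [CharP K p]
    (h2 : (2 : K) ≠ 0) {s : ℕ} (hs : s.Prime) (hsq : s ∣ Fintype.card K + 1)
    (φ : SL(2, K) →* End F W) (hU : FixedFree φ p) (hS : FixedFree φ s)
    {X : K × K × K} (hX : X ≠ 0) (hns : ¬ ∃ d, d ≠ 0 ∧ d ^ 2 = disc X) :
    ∑ g ∈ Finset.univ.filter (· ∈ torus X), φ g = 0 := by
  obtain ⟨t, htX, ht⟩ : ∃ t ∈ torus X, ∀ x, φ t x = x → x = 0 := by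
    by_cases h0 : disc X = 0
    · obtain ⟨x, y, z⟩ := X
      replace h0 : x ^ 2 + y * z = 0 := h0
      by_cases hy : y = 0
      · subst hy
        have hx : x = 0 := by simpa using h0
        subst hx
        have hz : z ≠ 0 := by
          rintro rfl
          exact hX rfl
        refine ⟨unip 0 1 (-z), ⟨1, ?_⟩, hU _ (orderOf_unip hp (by simp) (neg_ne_zero.2 hz))⟩
        simp [unip]
      · refine ⟨unip 1 (-x / y) y, ⟨1, ?_, ?_, ?_⟩, hU _ (orderOf_unip hp (by simp) hy)⟩ <;>
          simp [unip] <;> field_simp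
        · ring
        · linear_combination -h0
    · have hsq : ¬ IsSquare (disc X) := by
        rintro ⟨d, hd⟩
        refine hns ⟨d, ?_, by rw [hd]; ring⟩
        rintro rfl
        exact h0 (by simpa using hd)
      have := Fact.mk hs
      obtain ⟨t, ht⟩ := exists_prime_orderOf_dvd_card' (G := torus X) s
        (by rwa [card_torus h2 X hsq])
      exact ⟨t, t.2, hS _ (by rw [Subgroup.orderOf_coe, ht])⟩
  refine sum_eq_zero_of_fixedFree φ _ t (fun g => ?_) ht
  simp [Subgroup.mul_mem_cancel_left _ htX]

/-- For `s` dividing `q + 1`, an element of order `p` or of order `s` has a nonzero fixed vector. -/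
lemma not_fixedFree_and_fixedFree [Fintype SL(2, K)] [Nontrivial W] {p : ℕ} (hp : p.Prime)
    [CharP K p] (h2 : (2 : K) ≠ 0) (hq : (Fintype.card K : F) ^ 3 - Fintype.card K ≠ 0)
    (hG : (Fintype.card SL(2, K) : F) ≠ 0) {s : ℕ} (hs : s.Prime)
    (hsq : s ∣ Fintype.card K + 1) (φ : SL(2, K) →* End F W) (hneg : φ (-1) = 1)
    (hU : FixedFree φ p) (hS : FixedFree φ s) : False := by
  classical
  have hq0 : (Fintype.card K : F) ≠ 0 := by
    intro h
    rw [h] at hq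
    simp at hq
  have h1n : (1 : SL(2, K)) ≠ -1 := by
    intro h
    have h3 : (1 : K) = -1 := by simpa using congrArg (fun g : SL(2, K) => g 0 0) h
    exact h2 (by linear_combination h3)
  set C : End F W := conjSum φ 1 with hC
  have hCn : conjSum φ (-1) = C := by simp [hC, conjSum, hneg]
  -- Splitting off the central elements from a sum that vanishes.
  have hcentral : ∀ T : Finset SL(2, K), 1 ∈ T → -1 ∈ T → ∑ g ∈ T, φ g = 0 →
      ∑ g ∈ T.filter (fun g => g ≠ 1 ∧ g ≠ -1), conjSum φ g = -((2 : F) • C) := by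
    intro T hT1 hTn hT
    have h := sum_conjSum φ T
    rw [hT] at h
    simp only [mul_zero, zero_mul, Finset.sum_const_zero] at h
    rw [← Finset.sum_filter_add_sum_filter_not T (fun g => g ≠ 1 ∧ g ≠ -1)] at h
    have hpair : T.filter (fun g => ¬ (g ≠ 1 ∧ g ≠ -1)) = {1, -1} := by
      ext g
      simp only [Finset.mem_filter, Finset.mem_insert, Finset.mem_singleton]
      constructor
      · rintro ⟨-, h⟩
        tauto
      · rintro (rfl | rfl) <;> simp [hT1, hTn]
    rw [hpair, Finset.sum_pair h1n, hCn, ← hC] at h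
    rw [two_smul]
    exact eq_neg_of_add_eq_zero_left h
  have hall : ∑ g : SL(2, K), φ g = 0 :=
    sum_eq_zero_of_fixedFree φ _ (unip 1 0 1) (by simp)
      (hU _ (orderOf_unip hp (by simp) one_ne_zero))
  have hdouble : ∑ X ∈ Finset.univ.filter (fun X : K × K × K => X ≠ 0),
      ∑ g ∈ (Finset.univ.filter (· ∈ torus X)).filter (fun g => g ≠ 1 ∧ g ≠ -1), conjSum φ g =
      ∑ g ∈ Finset.univ.filter (fun g : SL(2, K) => g ≠ 1 ∧ g ≠ -1),
        ∑ X ∈ Finset.univ.filter (fun X : K × K × K => X ≠ 0 ∧ g ∈ torus X), conjSum φ g := by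
    refine Finset.sum_comm' fun X g => ?_
    simp only [Finset.mem_filter, Finset.mem_univ, true_and]
    tauto
  have hright : ∑ g ∈ Finset.univ.filter (fun g : SL(2, K) => g ≠ 1 ∧ g ≠ -1),
      ∑ X ∈ Finset.univ.filter (fun X : K × K × K => X ≠ 0 ∧ g ∈ torus X), conjSum φ g =
      (Fintype.card K - 1 : ℕ) • -((2 : F) • C) := by
    rw [← hcentral Finset.univ (by simp) (by simp) hall, Finset.smul_sum]
    refine Finset.sum_congr rfl fun g hg => ?_
    simp only [Finset.mem_filter, Finset.mem_univ, true_and] at hg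
    rw [Finset.sum_const, card_torus_containing h2 hg.1 hg.2]
  set n := (Finset.univ.filter fun X : K × K × K =>
    X ≠ 0 ∧ ¬ ∃ d, d ≠ 0 ∧ d ^ 2 = disc X).card with hn
  have hleft : ∑ X ∈ Finset.univ.filter (fun X : K × K × K => X ≠ 0),
      ∑ g ∈ (Finset.univ.filter (· ∈ torus X)).filter (fun g => g ≠ 1 ∧ g ≠ -1), conjSum φ g =
      n • -((2 : F) • C) := by
    rw [hn, ← Finset.filter_filter, ← Finset.sum_const]
    symm
    rw [Finset.sum_filter]
    refine Finset.sum_congr rfl fun X hX => Eq.symm ?_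
    simp only [Finset.mem_filter, Finset.mem_univ, true_and] at hX
    split_ifs with hsp
    · obtain ⟨d, hd, hdX⟩ := hsp
      refine Finset.sum_eq_zero fun g hg => ?_
      simp only [Finset.mem_filter, Finset.mem_univ, true_and] at hg
      exact conjSum_eq_zero_of_split hp h2 hq0 φ hU hd hdX hg.1 hg.2.1 hg.2.2
    · exact hcentral _ (by simp [one_mem]) (by simp [neg_one_mem_torus])
        (sum_torus_eq_zero hp h2 hs hsq φ hU hS hX hsp)
  have hfin := hleft.symm.trans (hdouble.trans hright)
  obtain ⟨w, hw⟩ := exists_ne (0 : W)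
  have hCw : C w = (Fintype.card SL(2, K) : F) • w := by
    rw [hC, conjSum_one, Module.End.natCast_apply, Nat.cast_smul_eq_nsmul]
  have hfw := LinearMap.congr_fun hfin w
  rw [← Nat.cast_smul_eq_nsmul F, ← Nat.cast_smul_eq_nsmul F] at hfw
  simp only [LinearMap.smul_apply, LinearMap.neg_apply, hCw, smul_neg, smul_smul, neg_inj] at hfw
  have hscal := smul_left_injective F hw hfw
  have hcount := congrArg (Nat.cast : ℕ → F) (card_nonsplit (K := K) h2)
  rw [← hn] at hcount
  rw [Nat.cast_sub Fintype.card_pos] at hscal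
  push_cast at hcount hscal
  have h0 : ((Fintype.card K : F) ^ 3 - Fintype.card K) * Fintype.card SL(2, K) = 0 := by
    linear_combination hscal - Fintype.card SL(2, K) * hcount
  exact mul_ne_zero hq hG h0

end NonsplitTorus

section ElementOrders

variable {K : Type*} [Field K]

lemma eq_one_or_neg_one_of_mem_center {g : SL(2, K)} (hg : g ∈ Subgroup.center SL(2, K)) :
    g = 1 ∨ g = -1 := by
  obtain ⟨c, -, hc⟩ := Matrix.SpecialLinearGroup.mem_center_iff.1 hg
  have h : ∀ i j, g i j = Matrix.scalar (Fin 2) c i j := fun i j => by rw [hc]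
  exact eq_one_or_neg_one (by simp [h]) (by simp [h]) (by simp [h])

lemma neg_one_mem_center : (-1 : SL(2, K)) ∈ Subgroup.center SL(2, K) :=
  Subgroup.mem_center_iff.2 fun g => by simp

lemma orderOf_mk_of_odd {g : SL(2, K)} (hg : Odd (orderOf g)) :
    orderOf (QuotientGroup.mk' (Subgroup.center SL(2, K)) g) = orderOf g := by
  refine Nat.dvd_antisymm (orderOf_map_dvd _ _) ?_
  have h := pow_orderOf_eq_one (QuotientGroup.mk' (Subgroup.center SL(2, K)) g)
  set k := orderOf (QuotientGroup.mk' (Subgroup.center SL(2, K)) g)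
  rw [← map_pow, QuotientGroup.mk'_apply, QuotientGroup.eq_one_iff] at h
  have h2 : g ^ (k * 2) = 1 := by
    rw [pow_mul]
    rcases eq_one_or_neg_one_of_mem_center h with h | h <;> simp [h]
  exact (Nat.Coprime.dvd_mul_right hg.coprime_two_right).1 (orderOf_dvd_of_pow_eq_one h2)

lemma two_dvd_card_psl2 [Finite K] : 2 ∣ Nat.card PSL(2, K) := by
  set S : SL(2, K) := sl2Mk 0 1 (-1) 0 (by ring)
  have hS : orderOf (QuotientGroup.mk' (Subgroup.center SL(2, K)) S) = 2 := by
    refine orderOf_eq_prime ?_ fun h => ?_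
    · rw [← map_pow, QuotientGroup.mk'_apply, QuotientGroup.eq_one_iff]
      convert neg_one_mem_center (K := K)
      apply sl2_ext <;> simp [pow_two, sl2_mul_apply, S]
    · rw [QuotientGroup.mk'_apply, QuotientGroup.eq_one_iff] at h
      have h01 : S 0 1 = 0 := by
        rcases eq_one_or_neg_one_of_mem_center h with h | h <;> simp [h]
      simp [S] at h01
  have h := orderOf_dvd_natCard (QuotientGroup.mk' (Subgroup.center SL(2, K)) S)
  rwa [hS] at h

variable [Fintype K]

lemma exists_orderOf_unit {n : ℕ} (hn : n.Prime) (h : n ∣ Fintype.card K - 1) :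
    ∃ a : Kˣ, orderOf a = n := by
  have := Fact.mk hn
  exact exists_prime_orderOf_dvd_card' (G := Kˣ) n (by
    classical rwa [Nat.card_eq_fintype_card, Fintype.card_units])

lemma exists_card_torus (h2 : (2 : K) ≠ 0) :
    ∃ X : K × K × K, Nat.card (torus X) = Fintype.card K + 1 := by
  have hchar : ringChar K ≠ 2 := by
    intro h
    have := ringChar.Nat.cast_ringChar (R := K)
    rw [h] at this
    exact h2 (by exact_mod_cast this)
  obtain ⟨D, hD⟩ := FiniteField.exists_nonsquare hchar
  exact ⟨(0, 1, D), card_torus h2 _ (by simpa [disc] using hD)⟩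

lemma exists_orderOf_eq {p : ℕ} (hp : p.Prime) [CharP K p] (h2 : (2 : K) ≠ 0) {n : ℕ}
    (hn : n.Prime) (h : n = p ∨ n ∣ Fintype.card K - 1 ∨ n ∣ Fintype.card K + 1) :
    ∃ g : SL(2, K), orderOf g = n := by
  rcases h with rfl | h | h
  · exact ⟨unip 1 0 1, orderOf_unip hn (Or.inl one_ne_zero) one_ne_zero⟩
  · obtain ⟨a, ha⟩ := exists_orderOf_unit hn h
    exact ⟨_, orderOf_diagElt hn ha⟩
  · obtain ⟨X, hX⟩ := exists_card_torus h2
    have := Fact.mk hn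
    obtain ⟨t, ht⟩ := exists_prime_orderOf_dvd_card' (G := torus X) n (by rwa [hX])
    exact ⟨t, by rw [Subgroup.orderOf_coe, ht]⟩

/-- Two distinct primes dividing `q + 1` are joined by an element of a nonsplit torus. -/
lemma exists_orderOf_eq_mul (h2 : (2 : K) ≠ 0) {r s : ℕ} (hr : r.Prime) (hs : s.Prime)
    (hrs : r ≠ s) (hrq : r ∣ Fintype.card K + 1) (hsq : s ∣ Fintype.card K + 1) :
    ∃ g : SL(2, K), orderOf g = r * s := by
  obtain ⟨X, hX⟩ := exists_card_torus h2
  have := Fact.mk hr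
  have := Fact.mk hs
  obtain ⟨t, ht⟩ := exists_prime_orderOf_dvd_card' (G := torus X) r (by rwa [hX])
  obtain ⟨u, hu⟩ := exists_prime_orderOf_dvd_card' (G := torus X) s (by rwa [hX])
  rw [← Subgroup.orderOf_coe] at ht hu
  refine ⟨t * u, ?_⟩
  rw [(commute_of_mem_torus t.2 u.2).orderOf_mul_eq_mul_orderOf_of_coprime, ht, hu]
  rw [ht, hu]
  exact (Nat.coprime_primes hr hs).2 hrs

lemma prime_dvd_card_sl2 {n : ℕ} (hn : n.Prime) (h : n ∣ Nat.card SL(2, K)) :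
    n ∣ Fintype.card K ∨ n ∣ Fintype.card K - 1 ∨ n ∣ Fintype.card K + 1 := by
  have hinj : Function.Injective (Matrix.SpecialLinearGroup.toGL : SL(2, K) →* GL (Fin 2) K) := by
    intro g h hgh
    exact Subtype.ext (congrArg Units.val hgh)
  have h1 := h.trans (Subgroup.card_dvd_of_injective _ hinj)
  rw [Matrix.card_GL_field, Fin.prod_univ_two] at h1
  simp only [Fin.val_zero, Fin.val_one, pow_zero, pow_one] at h1
  obtain ⟨q, hq⟩ : ∃ q, Fintype.card K = q + 1 :=
    ⟨Fintype.card K - 1, by have := Fintype.card_pos (α := K); omega⟩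
  rw [hq] at h1 ⊢
  have e1 : (q + 1) ^ 2 - 1 = q * (q + 1 + 1) := by
    rw [Nat.sub_eq_iff_eq_add (Nat.one_le_pow _ _ (by omega))]; ring
  have e2 : (q + 1) ^ 2 - (q + 1) = q * (q + 1) := by
    rw [Nat.sub_eq_iff_eq_add (Nat.le_self_pow (by norm_num) _)]; ring
  rw [e1, e2, hn.dvd_mul, hn.dvd_mul, hn.dvd_mul] at h1
  rw [Nat.add_sub_cancel]
  tauto

end ElementOrders

section SemidirectProduct

variable {G F W : Type*} [Group G] [Field F] [AddCommGroup W] [Module F W]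

lemma orderOf_mem_specSet (ρ : G →* (W ≃ₗ[F] W)) (g : G) :
    orderOf g ∈ specSet (Multiplicative W ⋊[(linearAut F W).comp ρ] G) :=
  ⟨SemidirectProduct.inr g, orderOf_injective _ SemidirectProduct.inr_injective g⟩

lemma mul_mem_specSet_of_fixed {w : ℕ} (hw : w.Prime) [CharP F w] (ρ : G →* (W ≃ₗ[F] W)) {g : G}
    (hg : (orderOf g).Coprime w) {x : W} (hx : x ≠ 0) (hfix : ρ g x = x) :
    orderOf g * w ∈ specSet (Multiplicative W ⋊[(linearAut F W).comp ρ] G) := by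
  have := Fact.mk hw
  have hxw : orderOf (Multiplicative.ofAdd x) = w := by
    refine orderOf_eq_prime ?_ (by simpa using hx)
    rw [← ofAdd_nsmul, ← Nat.cast_smul_eq_nsmul F, CharP.cast_eq_zero, zero_smul, ofAdd_zero]
  set i := SemidirectProduct.inl (φ := (linearAut F W).comp ρ) (Multiplicative.ofAdd x) with hi
  set k := SemidirectProduct.inr (φ := (linearAut F W).comp ρ) g with hk
  have ho1 : orderOf i = w :=
    (orderOf_injective _ SemidirectProduct.inl_injective _).trans hxw
  have ho2 : orderOf k = orderOf g := orderOf_injective _ SemidirectProduct.inr_injective g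
  have hcomm : Commute k i := by
    have h := SemidirectProduct.inl_aut (φ := (linearAut F W).comp ρ) g (Multiplicative.ofAdd x)
    have hf : (linearAut F W).comp ρ g (Multiplicative.ofAdd x) = Multiplicative.ofAdd x :=
      congrArg Multiplicative.ofAdd hfix
    rw [hf, map_inv, eq_mul_inv_iff_mul_eq] at h
    exact h.symm
  refine ⟨k * i, ?_⟩
  rw [hcomm.orderOf_mul_eq_mul_orderOf_of_coprime (by rwa [ho1, ho2]), ho1, ho2]

end SemidirectProduct

theorem psl2_not_coclique
    (v : ℕ) (hv : v.Prime) (hv3 : 3 < v)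
    (w : ℕ) (hw : w.Prime) (F : Type*) [Field F] [CharP F w]
    (W : Type*) [AddCommGroup W] [Module F W] [Nontrivial W]
    (hwG : ¬ w ∣ Nat.card PSL(2, ZMod v))
    (ρ : PSL(2, ZMod v) →* (W ≃ₗ[F] W))
    (r s : ℕ) (hr : r.Prime) (hs : s.Prime) (hrodd : Odd r) (hsodd : Odd s)
    (hrs : r ≠ s) (hrG : r ∣ Nat.card PSL(2, ZMod v)) (hsG : s ∣ Nat.card PSL(2, ZMod v)) :
    r * s ∈ specSet (Multiplicative W ⋊[(linearAut F W).comp ρ] PSL(2, ZMod v)) ∨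
    r * w ∈ specSet (Multiplicative W ⋊[(linearAut F W).comp ρ] PSL(2, ZMod v)) ∨
    s * w ∈ specSet (Multiplicative W ⋊[(linearAut F W).comp ρ] PSL(2, ZMod v)) := by
  classical
  have := Fact.mk hv
  have hcard : Fintype.card (ZMod v) = v := ZMod.card v
  have h2 : (2 : ZMod v) ≠ 0 := by
    intro h
    have h' := (CharP.cast_eq_zero_iff (ZMod v) v 2).1 (by exact_mod_cast h)
    exact absurd (Nat.le_of_dvd two_pos h') (by omega)
  have hw2 : w ≠ 2 := by
    rintro rfl
    exact hwG two_dvd_card_psl2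
  have hwn : ∀ n, n ∣ Nat.card PSL(2, ZMod v) → n ≠ w := by
    rintro n hn rfl
    exact hwG hn
  have hwv : ¬ (w = v ∨ w ∣ v - 1 ∨ w ∣ v + 1) := by
    intro h
    obtain ⟨g, hg⟩ := exists_orderOf_eq (K := ZMod v) hv h2 hw (by rwa [hcard])
    refine hwG ?_
    rw [← hg, ← orderOf_mk_of_odd (hg ▸ hw.odd_of_ne_two hw2)]
    exact orderOf_dvd_natCard _
  have hcases : ∀ n : ℕ, n.Prime → n ∣ Nat.card SL(2, ZMod v) →
      n = v ∨ n ∣ v - 1 ∨ n ∣ v + 1 := by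
    intro n hn h
    have h := prime_dvd_card_sl2 hn h
    rwa [hcard, Nat.prime_dvd_prime_iff_eq hn hv] at h
  have hG : (Fintype.card SL(2, ZMod v) : F) ≠ 0 := by
    rw [Ne, CharP.cast_eq_zero_iff F w, ← Nat.card_eq_fintype_card]
    exact fun h => hwv (hcases w hw h)
  have hqv : (v : F) ≠ 0 := by
    rw [Ne, CharP.cast_eq_zero_iff F w, Nat.prime_dvd_prime_iff_eq hw hv]
    exact fun h => hwv (Or.inl h)
  have hq3 : (v : F) ^ 3 - v ≠ 0 := by
    have h1 : ((v - 1 : ℕ) : F) ≠ 0 := by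
      rw [Ne, CharP.cast_eq_zero_iff F w]
      exact fun h => hwv (Or.inr (Or.inl h))
    have h3 : ((v + 1 : ℕ) : F) ≠ 0 := by
      rw [Ne, CharP.cast_eq_zero_iff F w]
      exact fun h => hwv (Or.inr (Or.inr h))
    rw [Nat.cast_sub hv.one_le] at h1
    push_cast at h1 h3
    rw [show (v : F) ^ 3 - v = v * (v - 1) * (v + 1) by ring]
    exact mul_ne_zero (mul_ne_zero hqv h1) h3
  let π := QuotientGroup.mk' (Subgroup.center SL(2, ZMod v))
  let φ : SL(2, ZMod v) →* End F W :=
    (LinearEquiv.automorphismGroup.toLinearMapMonoidHom.comp ρ).comp π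
  have hneg : φ (-1) = 1 := by
    have : π (-1) = 1 := (QuotientGroup.eq_one_iff _).2 neg_one_mem_center
    simp only [φ, MonoidHom.comp_apply, this, map_one]
  by_contra! hcon
  obtain ⟨hcon1, hcon2, hcon3⟩ := hcon
  have hfree : ∀ n : ℕ, n.Prime → Odd n → n ∣ Nat.card PSL(2, ZMod v) →
      n * w ∉ specSet (Multiplicative W ⋊[(linearAut F W).comp ρ] PSL(2, ZMod v)) →
      FixedFree φ n := by
    rintro n hn hodd hdvd hnot g rfl x hx
    by_contra h0
    have ho : orderOf (π g) = orderOf g := orderOf_mk_of_odd hodd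
    refine hnot (ho ▸ mul_mem_specSet_of_fixed hw ρ ?_ h0 hx)
    rw [ho]
    exact (Nat.coprime_primes hn hw).2 (hwn _ hdvd)
  have hFr := hfree r hr hrodd hrG hcon2
  have hFs := hfree s hs hsodd hsG hcon3
  have hsplit : ∀ n : ℕ, n.Prime → Odd n → FixedFree φ n → ¬ n ∣ v - 1 := by
    intro n hn hodd hfr hdvd
    obtain ⟨a, ha⟩ := exists_orderOf_unit (K := ZMod v) hn (by rwa [hcard])
    obtain ⟨x, hx, hfx⟩ := exists_fixed_of_diagElt (by rwa [hcard]) φ hn hodd ha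
    exact hx (hfr _ (orderOf_diagElt hn ha) x hfx)
  have hnonsplit : ∀ n : ℕ, n.Prime → n ∣ v + 1 → FixedFree φ v → FixedFree φ n → False :=
    fun n hn hdvd => not_fixedFree_and_fixedFree hv h2 (by rwa [hcard]) hG hn (by rwa [hcard])
      φ hneg
  have hquot := Subgroup.card_quotient_dvd_card (Subgroup.center SL(2, ZMod v))
  rcases hcases r hr (hrG.trans hquot) with hrv | hrv | hrv
  · rcases hcases s hs (hsG.trans hquot) with hsv | hsv | hsv
    · exact hrs (hrv.trans hsv.symm)
    · exact hsplit s hs hsodd hFs hsv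
    · exact hnonsplit s hs hsv (hrv ▸ hFr) hFs
  · exact hsplit r hr hrodd hFr hrv
  · rcases hcases s hs (hsG.trans hquot) with hsv | hsv | hsv
    · exact hnonsplit r hr hrv (hsv ▸ hFs) hFr
    · exact hsplit s hs hsodd hFs hsv
    · obtain ⟨g, hg⟩ := exists_orderOf_eq_mul (K := ZMod v) h2 hr hs hrs (by rwa [hcard])
        (by rwa [hcard])
      have ho : orderOf (π g) = orderOf g := orderOf_mk_of_odd (hg ▸ hrodd.mul hsodd)
      exact hcon1 (by rw [← hg, ← ho]; exact orderOf_mem_specSet ρ _)
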